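/- arXiv:1905.10513 — 2 statements merged into one kernel-verified Lean document; each statement's English description precedes it below -/
import Mathlib

section
/- Let q ∈ ℂ with |q| < 1 and let a, b, z ∈ ℂ with b ≠ 0 and b z q^m ≠ 1 for every integer m ≥ 0. Then (az;q)_∞ / (bz;q)_∞ = ∑_{n=0}^∞ [ (aq/b;q)_n (az;q)_n / ((q;q)_n (bz;q)_n) ] · (bz)^n q^{n(n−1)} (1 − a z q^{2n}), the series on the right being absolutely convergent. -/
/-- The finite q-Pochhammer symbol `(x;q)_n = ∏_{i=0}^{n-1} (1 - x q^i)`. -/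
noncomputable def qPoch (q x : ℂ) (n : ℕ) : ℂ :=
  ∏ i ∈ Finset.range n, (1 - x * q ^ i)

open Filter Topology in
theorem qP_tendsto (q x : ℂ) (hq : ‖q‖ < 1) :
    Tendsto (qPoch q x) atTop (𝓝 (∏' i : ℕ, (1 - x * q ^ i))) := by
  have hs : Summable (fun i : ℕ => -(x * q ^ i)) :=
    ((summable_geometric_of_norm_lt_one hq).mul_left x).neg
  have hm := Complex.multipliable_one_add_of_summable hs
  simp only [← sub_eq_add_neg] at hm
  exact hm.hasProd.tendsto_prod_nat

theorem qP_inf_ne (q x : ℂ) (hq : ‖q‖ < 1) (hx : ∀ m : ℕ, x * q ^ m ≠ 1) :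
    (∏' i : ℕ, (1 - x * q ^ i)) ≠ 0 := by
  have hs : Summable (fun i : ℕ => ‖-(x * q ^ i)‖) :=
    ((summable_geometric_of_norm_lt_one hq).mul_left x).neg.norm
  have := tprod_one_add_ne_zero_of_summable (f := fun i : ℕ => -(x * q ^ i))
    (fun i h => hx i (by linear_combination -h)) hs
  simpa only [← sub_eq_add_neg] using this

theorem qP_ne (q x : ℂ) (hx : ∀ m : ℕ, x * q ^ m ≠ 1) (n : ℕ) : qPoch q x n ≠ 0 :=
  Finset.prod_ne_zero_iff.2 fun i _ h => hx i (by linear_combination -h)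

theorem qP_succ (q x : ℂ) (n : ℕ) : qPoch q x (n + 1) = qPoch q x n * (1 - x * q ^ n) :=
  Finset.prod_range_succ _ _

open Filter Topology in
theorem qP_bdd (f : ℕ → ℂ) (l : ℂ) (h : Tendsto f atTop (𝓝 l)) : ∃ C, ∀ n, ‖f n‖ ≤ C := by
  obtain ⟨C, hC⟩ := (h.norm).bddAbove_range
  exact ⟨C, fun n => hC ⟨n, rfl⟩⟩

theorem qP_expo (n : ℕ) : (n + 1) * (n + 1 - 1) = n * (n - 1) + 2 * n := by
  cases n with
  | zero => rfl
  | succ k => simp only [Nat.add_sub_cancel]; ring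

open Filter Topology in
theorem qP_summ (q y : ℂ) (hq : ‖q‖ < 1) :
    Summable (fun n : ℕ => ‖y ^ n * q ^ (n * (n - 1))‖) := by
  refine Summable.norm ?_
  have h0 : Tendsto (fun n : ℕ => ‖y * (q ^ n) ^ 2‖) atTop (𝓝 0) := by
    have := (((tendsto_pow_atTop_nhds_zero_of_norm_lt_one hq).pow 2).const_mul y).norm
    simpa using this
  refine summable_of_ratio_norm_eventually_le (r := 1 / 2) (by norm_num) ?_
  filter_upwards [h0.eventually_le_const (show (0 : ℝ) < 1 / 2 by norm_num)] with n hn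
  have : y ^ (n + 1) * q ^ ((n + 1) * (n + 1 - 1))
      = (y * (q ^ n) ^ 2) * (y ^ n * q ^ (n * (n - 1))) := by
    rw [qP_expo]; ring
  rw [this, norm_mul]
  gcongr

/-- the telescoping family -/
noncomputable def qU (q A y c : ℂ) (N n : ℕ) : ℂ :=
  qPoch q c n / qPoch q q n * (qPoch q A (N + n) / qPoch q y (N + n)) * (q ^ N) ^ n *
    (1 - A * q ^ (N + 2 * n)) * (y ^ n * q ^ (n * (n - 1)))

/-- the telescoping certificate -/
noncomputable def qG (q A y c : ℂ) (N n : ℕ) : ℂ :=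
  - (qPoch q c n / qPoch q q n * (qPoch q A (N + n) / qPoch q y (N + n)) * (q ^ N) ^ n *
    (1 - q ^ n) * (y ^ n * q ^ (n * (n - 1))))

theorem qU_tele (q A y c : ℂ) (h : c * y = A * q) (hqq : ∀ m : ℕ, q * q ^ m ≠ 1)
    (hy : ∀ m : ℕ, y * q ^ m ≠ 1) (N n : ℕ) :
    qU q A y c N n - qU q A y c (N + 1) n = qG q A y c N (n + 1) - qG q A y c N n := by
  have e1 : N + 1 + n = N + n + 1 := by ring
  have h1 := qP_ne q q hqq n
  have h2 := qP_ne q y hy (N + n)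
  have h3 : 1 - q * q ^ n ≠ 0 := fun h => hqq n (by linear_combination -h)
  have h4 : 1 - y * q ^ (N + n) ≠ 0 := fun h => hy (N + n) (by linear_combination -h)
  unfold qU qG
  rw [qP_expo, ← add_assoc N n 1, e1]
  simp only [qP_succ]
  have e2 : q ^ (n + 1) = q * q ^ n := by ring
  have e3 : q ^ (N + n) = q ^ N * q ^ n := by ring
  have e4 : q ^ (N + 2 * n) = q ^ N * (q ^ n) ^ 2 := by ring
  have e5 : q ^ (N + 1 + 2 * n) = q * q ^ N * (q ^ n) ^ 2 := by ring
  have e6 : (q ^ (N + 1)) ^ n = (q ^ N) ^ n * q ^ n := by ring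
  have e7 : q ^ (n * (n - 1) + 2 * n) = q ^ (n * (n - 1)) * (q ^ n) ^ 2 := by ring
  have e8 : (q ^ N) ^ (n + 1) = (q ^ N) ^ n * q ^ N := by ring
  have e9 : y ^ (n + 1) = y ^ n * y := by ring
  rw [e3] at h4
  rw [e2, e3, e4, e5, e6, e7, e8, e9]
  generalize (q ^ N) ^ n = R at *
  generalize q ^ (n * (n - 1)) = T at *
  generalize q ^ N = M at *
  generalize q ^ n = Q at *
  generalize y ^ n = Y at *
  generalize qPoch q q n = P1 at *
  generalize qPoch q c n = P2 at *
  generalize qPoch q A (N + n) = P3 at *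
  generalize qPoch q y (N + n) = P4 at *
  obtain ⟨E, hE⟩ : ∃ E, E = 1 - q * Q := ⟨_, rfl⟩
  obtain ⟨F, hF⟩ : ∃ F, F = 1 - y * (M * Q) := ⟨_, rfl⟩
  rw [← hE] at h3
  rw [← hF] at h4
  rw [← hE, ← hF]
  have key : (1 - A * (M * Q ^ 2)) - (1 - A * (M * Q)) * F⁻¹ * Q * (1 - A * (q * M * Q ^ 2))
      = -((1 - c * Q) * (1 - A * (M * Q)) * F⁻¹ * M * y * Q ^ 2) + (1 - Q) := by
    have hFF : F * F⁻¹ = 1 := mul_inv_cancel₀ h4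
    have hp : (1 - A * (M * Q ^ 2)) * F - (1 - A * (M * Q)) * Q * (1 - A * (q * M * Q ^ 2))
        = -((1 - c * Q) * (1 - A * (M * Q)) * M * y * Q ^ 2) + (1 - Q) * F := by
      rw [hF]
      linear_combination (-(Q ^ 3 * M * (1 - A * (M * Q)))) * h
    linear_combination F⁻¹ * hp - ((1 - A * (M * Q ^ 2)) - (1 - Q)) * hFF
  have hEE : E * E⁻¹ = 1 := mul_inv_cancel₀ h3
  linear_combination (P2 / P1 * (P3 / P4) * R * Y * T) * key
    + (P3 / P4 * (1 - A * (M * Q)) * F⁻¹ * R * M * Y * y * T * Q ^ 2 * P2 / P1 * (1 - c * Q)) * hEE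

open Filter Topology in
theorem qU_main (q A y c : ℂ) (hq : ‖q‖ < 1) (h : c * y = A * q)
    (hy : ∀ m : ℕ, y * q ^ m ≠ 1) :
    Summable (qU q A y c 0) ∧
    (∏' i : ℕ, (1 - A * q ^ i)) / (∏' i : ℕ, (1 - y * q ^ i)) = ∑' n, qU q A y c 0 n := by
  have hqq : ∀ m : ℕ, q * q ^ m ≠ 1 := by
    intro m hm
    have h1 : ‖q ^ (m + 1)‖ < 1 := by
      rw [norm_pow]; exact pow_lt_one₀ (norm_nonneg _) hq (by simp)
    rw [pow_succ', hm] at h1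
    simp at h1
  have hql : ∀ n : ℕ, ‖q ^ n‖ ≤ 1 := fun n => by
    rw [norm_pow]; exact pow_le_one₀ (norm_nonneg _) hq.le
  have hw := (qP_tendsto q A hq).div (qP_tendsto q y hq) (qP_inf_ne q y hq hy)
  obtain ⟨C, hC⟩ := qP_bdd _ _
    ((qP_tendsto q c hq).div (qP_tendsto q q hq) (qP_inf_ne q q hq hqq))
  obtain ⟨D, hD⟩ := qP_bdd _ _ hw
  simp only [Pi.div_apply] at hC hD
  have hC0 : 0 ≤ C := (norm_nonneg _).trans (hC 0)
  have hD0 : 0 ≤ D := (norm_nonneg _).trans (hD 0)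
  have hs := qP_summ q y hq
  have hR : ∀ N n : ℕ, ‖(q ^ N) ^ n‖ ≤ 1 := fun N n => by rw [← pow_mul]; exact hql _
  have hbU : ∀ N n, ‖qU q A y c N n‖ ≤ C * D * 1 * (1 + ‖A‖) * ‖y ^ n * q ^ (n * (n - 1))‖ := by
    intro N n
    have h1 : ‖1 - A * q ^ (N + 2 * n)‖ ≤ 1 + ‖A‖ := by
      refine (norm_sub_le _ _).trans ?_
      rw [norm_one, norm_mul]
      have := mul_le_mul_of_nonneg_left (hql (N + 2 * n)) (norm_nonneg A)
      linarith
    unfold qU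
    rw [norm_mul, norm_mul, norm_mul, norm_mul]
    gcongr
    exacts [hC n, hD _, hR N n]
  have hbG : ∀ N n, ‖qG q A y c N n‖ ≤ C * D * 1 * 2 * ‖y ^ n * q ^ (n * (n - 1))‖ := by
    intro N n
    have h1 : ‖1 - q ^ n‖ ≤ 2 := by
      refine (norm_sub_le _ _).trans ?_
      rw [norm_one]
      linarith [hql n]
    unfold qG
    rw [norm_neg, norm_mul, norm_mul, norm_mul, norm_mul]
    gcongr
    exacts [hC n, hD _, hR N n]
  have hsU : ∀ N, Summable (qU q A y c N) := fun N =>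
    Summable.of_norm_bounded (hs.mul_left _) (hbU N)
  have hG0 : ∀ N, Tendsto (qG q A y c N) atTop (𝓝 0) := fun N => by
    refine squeeze_zero_norm (hbG N) ?_
    simpa using hs.tendsto_atTop_zero.const_mul (C * D * 1 * 2)
  have hstep : ∀ N, ∑' n, qU q A y c N n = ∑' n, qU q A y c (N + 1) n := by
    intro N
    have h1 := ((hsU N).hasSum.sub (hsU (N + 1)).hasSum).tendsto_sum_nat
    simp only [qU_tele q A y c h hqq hy, Finset.sum_range_sub] at h1
    have h2 := tendsto_nhds_unique h1 ((hG0 N).sub_const _)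
    have h3 : qG q A y c N 0 = 0 := by simp [qG]
    rw [h3, sub_zero] at h2
    exact sub_eq_zero.1 h2
  have hconst : ∀ N, ∑' n, qU q A y c N n = ∑' n, qU q A y c 0 n := by
    intro N
    induction N with
    | zero => rfl
    | succ k ih => rw [← hstep, ih]
  refine ⟨hsU 0, ?_⟩
  set L := (∏' i : ℕ, (1 - A * q ^ i)) / (∏' i : ℕ, (1 - y * q ^ i)) with hL
  have hlim := tendsto_tsum_of_dominated_convergence (𝓕 := atTop) (f := fun N n => qU q A y c N n)
    (g := fun n => if n = 0 then L else 0)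
    (hs.mul_left (C * D * 1 * (1 + ‖A‖))) ?_ (Eventually.of_forall hbU)
  · simp only [hconst, tsum_ite_eq] at hlim
    exact tendsto_nhds_unique hlim tendsto_const_nhds
  · intro n
    have hqN := tendsto_pow_atTop_nhds_zero_of_norm_lt_one hq
    have t1 : Tendsto (fun N => qPoch q A (N + n) / qPoch q y (N + n)) atTop (𝓝 L) :=
      hw.comp (tendsto_add_atTop_nat n)
    have t2 : Tendsto (fun N : ℕ => 1 - A * q ^ (N + 2 * n)) atTop (𝓝 (1 - A * 0)) :=
      ((hqN.comp (tendsto_add_atTop_nat (2 * n))).const_mul A).const_sub 1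
    have t := (((t1.const_mul (qPoch q c n / qPoch q q n)).mul (hqN.pow n)).mul t2).mul_const
      (y ^ n * q ^ (n * (n - 1)))
    refine (t.congr fun N => rfl).trans (le_of_eq ?_)
    congr 1
    rcases eq_or_ne n 0 with rfl | hn
    · simp [qPoch]
    · simp [hn]

/-- `(az;q)_∞/(bz;q)_∞
  = ∑_n (aq/b;q)_n (az;q)_n / ((q;q)_n (bz;q)_n) (bz)^n q^{n(n−1)} (1 − a z q^{2n})`,
the series being absolutely convergent. -/
theorem infinite_product_expansion (q a b z : ℂ) (hq : ‖q‖ < 1) (hb : b ≠ 0)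
    (hbz : ∀ m : ℕ, b * z * q ^ m ≠ 1) :
    Summable (fun n : ℕ =>
      qPoch q (a * q / b) n * qPoch q (a * z) n /
          (qPoch q q n * qPoch q (b * z) n) *
        (b * z) ^ n * q ^ (n * (n - 1)) * (1 - a * z * q ^ (2 * n))) ∧
    (∏' i : ℕ, (1 - a * z * q ^ i)) / (∏' i : ℕ, (1 - b * z * q ^ i))
      = ∑' n : ℕ,
          qPoch q (a * q / b) n * qPoch q (a * z) n /
              (qPoch q q n * qPoch q (b * z) n) *
            (b * z) ^ n * q ^ (n * (n - 1)) * (1 - a * z * q ^ (2 * n)) := by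
  have h := qU_main q (a * z) (b * z) (a * q / b) hq (by field_simp) hbz
  have e : qU q (a * z) (b * z) (a * q / b) 0 = (fun n : ℕ =>
      qPoch q (a * q / b) n * qPoch q (a * z) n /
          (qPoch q q n * qPoch q (b * z) n) *
        (b * z) ^ n * q ^ (n * (n - 1)) * (1 - a * z * q ^ (2 * n))) := by
    funext n
    simp only [qU, zero_add, pow_zero, one_pow, mul_one]
    rw [div_mul_div_comm]
    ring
  rw [e] at h
  exact h
end

section
/- Let q ∈ ℂ with |q| < 1, and let A, B, C, z ∈ ℂ with A ≠ 0, B ≠ 0, C ≠ 0, C ≠ q^{−m} for all integers m ≥ 0, |z| < 1, and |ABz/C| < 1. Then ∑_{k=0}^∞ (A;q)_k (B;q)_k / ((q;q)_k (C;q)_k) · z^k = ∑_{n=0}^∞ [ (ABq/C;q)_n (ABz/C;q)_n / ((q;q)_n (z;q)_n) ] · z^n q^{n(n−1)} (1 − A B z q^{2n}/C) · Φ_n, where Φ_n = ∑_{k=0}^∞ (ABzq^n/C;q)_k (ABzq^{2n+1}/C;q)_k (C/A;q)_k (C/B;q)_k / ((q;q)_k (C;q)_k (zq^n;q)_k (ABzq^{2n}/C;q)_k)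 · (A B z q^n/C)^k, and all series involved converge absolutely. -/
/-- The inner `₄φ₃` series `Φ_n` of the ₂φ₁ transformation. -/
noncomputable def PhiTerm (q A B C z : ℂ) (n k : ℕ) : ℂ :=
  qPoch q (A * B * z * q ^ n / C) k * qPoch q (A * B * z * q ^ (2 * n + 1) / C) k *
      qPoch q (C / A) k * qPoch q (C / B) k /
    (qPoch q q k * qPoch q C k * qPoch q (z * q ^ n) k *
      qPoch q (A * B * z * q ^ (2 * n) / C) k) *
    (A * B * z * q ^ n / C) ^ k

lemma qPoch_succ (q x : ℂ) (n : ℕ) : qPoch q x (n+1) = qPoch q x n * (1 - x * q ^ n) := by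
  simp [qPoch, Finset.prod_range_succ]

lemma qPoch_zero (q x : ℂ) : qPoch q x 0 = 1 := by simp [qPoch]

lemma qPoch_add (q x : ℂ) (n k : ℕ) :
    qPoch q x (n+k) = qPoch q x n * qPoch q (x * q ^ n) k := by
  simp only [qPoch, Finset.prod_range_add]
  congr 1
  apply Finset.prod_congr rfl
  intro i _
  rw [pow_add]; ring

lemma qPoch_shift (q y : ℂ) (k : ℕ) :
    (1 - y) * qPoch q (y * q) k = qPoch q y k * (1 - y * q ^ k) := by
  rw [← qPoch_succ, add_comm k 1, qPoch_add]
  simp [qPoch_succ, qPoch_zero]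

lemma qPoch_ne (q x : ℂ) (h : ∀ i : ℕ, 1 - x * q ^ i ≠ 0) (n : ℕ) : qPoch q x n ≠ 0 :=
  Finset.prod_ne_zero_iff.mpr fun i _ => h i

lemma one_sub_ne (q x : ℂ) (hq : ‖q‖ < 1) (hx : ‖x‖ < 1) (i : ℕ) : 1 - x * q ^ i ≠ 0 := by
  intro h
  have h1 : x * q ^ i = 1 := (sub_eq_zero.mp h).symm
  have h2 : ‖x * q ^ i‖ < 1 := by
    rw [norm_mul, norm_pow]
    calc ‖x‖ * ‖q‖ ^ i ≤ ‖x‖ * 1 := by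
          gcongr; exact pow_le_one₀ (norm_nonneg _) hq.le
      _ < 1 := by simpa using hx
  rw [h1] at h2; simp at h2

lemma prod_bdd (w : ℕ → ℂ) (hw : Summable fun i => ‖w i‖) :
    ∃ M : ℝ, 0 ≤ M ∧ ∀ n, ‖∏ i ∈ Finset.range n, (1 + w i)‖ ≤ M := by
  refine ⟨Real.exp (∑' i, ‖w i‖), (Real.exp_pos _).le, fun n => ?_⟩
  calc ‖∏ i ∈ Finset.range n, (1 + w i)‖ = ∏ i ∈ Finset.range n, ‖1 + w i‖ := norm_prod _ _
    _ ≤ ∏ i ∈ Finset.range n, Real.exp ‖w i‖ := by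
        apply Finset.prod_le_prod (fun _ _ => norm_nonneg _)
        intro i _
        calc ‖1 + w i‖ ≤ ‖(1:ℂ)‖ + ‖w i‖ := norm_add_le _ _
          _ = ‖w i‖ + 1 := by simp [add_comm]
          _ ≤ _ := Real.add_one_le_exp _
    _ = Real.exp (∑ i ∈ Finset.range n, ‖w i‖) := (Real.exp_sum _ _).symm
    _ ≤ _ := Real.exp_le_exp.mpr (hw.sum_le_tsum _ fun _ _ => norm_nonneg _)

lemma summ_geo (q x : ℂ) (hq : ‖q‖ < 1) : Summable fun i : ℕ => ‖x * q ^ i‖ := by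
  simp only [norm_mul, norm_pow]
  exact (summable_geometric_of_lt_one (norm_nonneg _) hq).mul_left _

lemma qPoch_bdd (q x : ℂ) (hq : ‖q‖ < 1) : ∃ M : ℝ, 0 ≤ M ∧ ∀ n, ‖qPoch q x n‖ ≤ M := by
  obtain ⟨M, h0, h⟩ := prod_bdd (fun i => -(x * q ^ i)) (by simpa using summ_geo q x hq)
  exact ⟨M, h0, fun n => by simpa [qPoch, sub_eq_add_neg] using h n⟩

lemma qPoch_inv_bdd (q x : ℂ) (hq : ‖q‖ < 1) (hx : ∀ i : ℕ, 1 - x * q ^ i ≠ 0) :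
    ∃ M : ℝ, 0 ≤ M ∧ ∀ n, ‖(qPoch q x n)⁻¹‖ ≤ M := by
  have hs : Summable fun i : ℕ => ‖x * q ^ i / (1 - x * q ^ i)‖ := by
    have ht : Filter.Tendsto (fun i : ℕ => 1 - x * q ^ i) Filter.atTop (nhds 1) := by
      have := ((tendsto_pow_atTop_nhds_zero_of_norm_lt_one hq).const_mul x).const_sub 1
      simpa using this
    have ht2 : ∀ᶠ i : ℕ in Filter.atTop, (1/2 : ℝ) < ‖1 - x * q ^ i‖ := by
      have := ht.norm
      apply this.eventually_const_lt
      norm_num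
    apply Summable.of_norm_bounded_eventually_nat ((summ_geo q x hq).mul_left 2)
    filter_upwards [ht2] with i hi
    rw [norm_norm, norm_div, div_le_iff₀ (by linarith)]
    nlinarith [norm_nonneg (x * q ^ i)]
  obtain ⟨M, h0, h⟩ := prod_bdd _ hs
  refine ⟨M, h0, fun n => ?_⟩
  convert h n using 2
  rw [qPoch, ← Finset.prod_inv_distrib]
  apply Finset.prod_congr rfl
  intro i _
  have := hx i
  field_simp
  ring

lemma geo_summable (c : ℕ → ℂ) (M : ℝ) (hc : ∀ n, ‖c n‖ ≤ M) (z : ℂ) (hz : ‖z‖ < 1) :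
    Summable fun n => ‖c n * z ^ n‖ := by
  apply Summable.of_nonneg_of_le (fun _ => norm_nonneg _) (fun n => ?_)
    ((summable_geometric_of_lt_one (norm_nonneg z) hz).mul_left M)
  rw [norm_mul, norm_pow]
  gcongr
  exact hc n

/-! formal identity -/
open PowerSeries in
lemma ps_iff (q C α β γ : ℂ) (hq0 : q ≠ 0) (f : PowerSeries ℂ) :
    (PowerSeries.C q * f + X * (PowerSeries.C (-q * α) * f)
      = PowerSeries.C q * rescale q f + PowerSeries.C C * rescale q f + X * (PowerSeries.C (- q * β) * rescale q f)
        + PowerSeries.C (-C) * rescale q (rescale q f)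
        + X * (PowerSeries.C (q * γ) * rescale q (rescale q f))) ↔
    ∀ k : ℕ, coeff (k+1) f * ((1 - q ^ (k+1)) * (1 - C * q ^ k))
      = coeff k f * (α - β * q ^ k + γ * q ^ (2 * k)) := by
  rw [PowerSeries.ext_iff]
  constructor
  · intro h k
    have := h (k+1)
    simp only [map_add, coeff_succ_X_mul, coeff_C_mul, coeff_rescale] at this
    apply mul_left_cancel₀ hq0
    linear_combination this
  · intro h n
    cases n with
    | zero =>
      simp only [map_add, coeff_zero_X_mul, coeff_C_mul, coeff_rescale]; ring
    | succ k =>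
      simp only [map_add, coeff_succ_X_mul, coeff_C_mul, coeff_rescale]
      linear_combination q * h k

lemma rec_unique (q C : ℂ) (r c d : ℕ → ℂ) (h1 : ∀ k : ℕ, 1 - q ^ (k+1) ≠ 0)
    (h2 : ∀ k : ℕ, 1 - C * q ^ k ≠ 0) (h0 : c 0 = d 0)
    (hc : ∀ k : ℕ, c (k+1) * ((1 - q ^ (k+1)) * (1 - C * q ^ k)) = c k * r k)
    (hd : ∀ k : ℕ, d (k+1) * ((1 - q ^ (k+1)) * (1 - C * q ^ k)) = d k * r k) :
    ∀ n, c n = d n := by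
  intro n
  induction n with
  | zero => exact h0
  | succ k ih =>
    apply mul_right_cancel₀ (mul_ne_zero (h1 k) (h2 k))
    rw [hc, hd, ih]

/-- coefficients -/
noncomputable def cc (q A B C : ℂ) (k : ℕ) : ℂ :=
  qPoch q A k * qPoch q B k / (qPoch q q k * qPoch q C k)

noncomputable def pp (q a : ℂ) (k : ℕ) : ℂ := qPoch q a k / qPoch q q k

lemma cc_rec (q A B C : ℂ) (h1 : ∀ k : ℕ, 1 - q * q ^ k ≠ 0)
    (h2 : ∀ k : ℕ, 1 - C * q ^ k ≠ 0) (k : ℕ) :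
    cc q A B C (k+1) * ((1 - q ^ (k+1)) * (1 - C * q ^ k))
      = cc q A B C k * ((1 - A * q ^ k) * (1 - B * q ^ k)) := by
  have e1 := h1 k
  rw [mul_comm] at e1
  have e2 := h2 k
  rw [mul_comm] at e2
  have e3 := qPoch_ne q q h1 k
  have e4 := qPoch_ne q C h2 k
  simp only [cc, qPoch_succ, pow_succ']
  field_simp

lemma pp_rec (q a : ℂ) (h1 : ∀ k : ℕ, 1 - q * q ^ k ≠ 0) (k : ℕ) :
    pp q a (k+1) * (1 - q ^ (k+1)) = pp q a k * (1 - a * q ^ k) := by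
  have e1 := h1 k
  rw [mul_comm] at e1
  have e3 := qPoch_ne q q h1 k
  simp only [pp, qPoch_succ, pow_succ']
  field_simp

open PowerSeries in
lemma ps_P (q a : ℂ) (h1 : ∀ k : ℕ, 1 - q * q ^ k ≠ 0) :
    (1 - X) * mk (pp q a) = (1 - PowerSeries.C a * X) * rescale q (mk (pp q a)) := by
  have : mk (pp q a) - X * mk (pp q a) =
    rescale q (mk (pp q a)) - X * (PowerSeries.C a * rescale q (mk (pp q a))) := by
    ext n
    cases n with
    | zero =>
      simp only [map_sub, coeff_zero_X_mul, coeff_rescale]; simp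
    | succ k =>
      simp only [map_sub, coeff_succ_X_mul, coeff_C_mul, coeff_rescale, coeff_mk]
      linear_combination pp_rec q a h1 k
  linear_combination this

open PowerSeries in
lemma saal (q A B C : ℂ) (hA : A ≠ 0) (hB : B ≠ 0) (hC : C ≠ 0)
    (h1 : ∀ k : ℕ, 1 - q * q ^ k ≠ 0)
    (h2 : ∀ k : ℕ, 1 - C * q ^ k ≠ 0) (n : ℕ) :
    cc q A B C n = ∑ ij ∈ Finset.HasAntidiagonal.antidiagonal n,
      pp q (A * B / C) ij.1 * (cc q (C/A) (C/B) C ij.2 * (A * B / C) ^ ij.2) := by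
  set a := A * B / C with ha
  set P := mk (pp q a) with hP
  set H := mk (fun k => cc q (C/A) (C/B) C k * a ^ k) with hH
  have hmul : ∑ ij ∈ Finset.HasAntidiagonal.antidiagonal n,
      pp q a ij.1 * (cc q (C/A) (C/B) C ij.2 * a ^ ij.2) = coeff n (P * H) := by
    simp [coeff_mul, hP, hH]
  rw [hmul]
  have h00 : coeff 0 (P * H) = 1 := by
    rw [coeff_mul]; simp [hP, hH, pp, cc, qPoch_zero]
  have haC : a * C = A * B := by rw [ha]; field_simp
  have e1 : a * (C / A) = B := by rw [ha]; field_simp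
  have e2 : a * (C / B) = A := by rw [ha]; field_simp
  have hPe := ps_P q a h1
  rw [← hP] at hPe
  have h1' : ∀ k : ℕ, 1 - q ^ (k+1) ≠ 0 := fun k => by rw [pow_succ']; exact h1 k
  have hHrec : ∀ k : ℕ, coeff (k+1) H * ((1 - q ^ (k+1)) * (1 - C * q ^ k))
      = coeff k H * (a - (A + B) * q ^ k + C * q ^ (2 * k)) := by
    intro k
    have := cc_rec q (C/A) (C/B) C h1 h2 k
    simp only [hH, coeff_mk]
    have e4 : a * ((1 - C / A * q ^ k) * (1 - C / B * q ^ k)) =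
        a - (A + B) * q ^ k + C * q ^ (2 * k) := by
      linear_combination (-q^k) * e1 + (- q ^k + q^(2*k) * (C / A)) * e2 +
        q^(2*k) * (by field_simp : C / A * A = C)
    rw [← e4]
    linear_combination a ^ (k+1) * this
  by_cases hq0 : q = 0
  · have eP : (1 - X) * P = 1 - PowerSeries.C a * X := by
      rw [hPe, hq0]
      have : rescale (0:ℂ) P = 1 := by
        rw [rescale_zero_apply]
        simp [hP, pp, qPoch_zero, constantCoeff_mk]
      rw [this, mul_one]
    set F := mk (cc q A B C) with hF
    set K := (1 - A) * (1 - B) / (1 - C) with hK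
    have hC1 : 1 - C ≠ 0 := by simpa using h2 0
    have eF : (1 - X) * F = 1 + PowerSeries.C (K - 1) * X := by
      have : F - X * F = 1 + X * PowerSeries.C (K - 1) := by
        ext n
        cases n with
        | zero => simp [hF, cc, qPoch_zero]
        | succ k =>
          simp only [map_sub, map_add, coeff_succ_X_mul, hF, coeff_mk, coeff_one, coeff_C]
          have := cc_rec q A B C h1 h2 k
          subst hq0
          cases k with
          | zero =>
            simp [cc, qPoch_zero, qPoch_succ, hK]
          | succ k =>
            simp at this ⊢
            rw [this]; simp
      linear_combination this
    have eH : (1 - PowerSeries.C a * X) * H = 1 + PowerSeries.C (K - 1) * X := by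
      have : H - X * (PowerSeries.C a * H) = 1 + X * PowerSeries.C (K - 1) := by
        ext n
        cases n with
        | zero => simp [hH, cc, qPoch_zero]
        | succ k =>
          simp only [map_sub, map_add, coeff_succ_X_mul, coeff_one, coeff_C, coeff_C_mul]
          have := hHrec k
          subst hq0
          cases k with
          | zero =>
            simp at this
            have hH0 : constantCoeff H = 1 := by simp [hH, cc, qPoch_zero, constantCoeff_mk]
            simp [hH0] at this ⊢
            apply mul_right_cancel₀ hC1
            rw [sub_mul, this, hK]
            field_simp
            linear_combination haC
          | succ k =>
            simp at this ⊢
            rw [this]; ring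
      linear_combination this
    have hX : (1 - X : PowerSeries ℂ) ≠ 0 := by
      intro h
      have := congrArg (coeff 0) h
      simp at this
    have : F = P * H := by
      apply mul_left_cancel₀ hX
      rw [← mul_assoc, eP, eH, eF]
    rw [← this, hF, coeff_mk]
  · have hrec := (ps_iff q C a (A + B) C hq0 H).mpr hHrec
    have hPe2 := congrArg (rescale q) hPe
    simp only [map_mul, map_sub, map_one, rescale_X] at hPe2
    have hCr : rescale q (PowerSeries.C a) = PowerSeries.C a := by
      ext n; simp only [coeff_rescale, coeff_C]; split_ifs with h <;> simp [h]
    rw [hCr] at hPe2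
    have hPH := (ps_iff q C 1 (A + B) (A * B) hq0 (P * H)).mp (by
      have hac : PowerSeries.C a * PowerSeries.C C = PowerSeries.C A * PowerSeries.C B := by
        rw [← map_mul, ← map_mul, haC]
      simp only [map_mul, map_add, map_neg, map_one] at hrec ⊢
      linear_combination rescale q P * hrec + PowerSeries.C q * H * hPe
        - PowerSeries.C C * rescale q (rescale q H) * hPe2
        + PowerSeries.C q * X * rescale q (rescale q P) * rescale q (rescale q H) * hac)
    refine rec_unique q C (fun k => 1 - (A + B) * q ^ k + A * B * q ^ (2 * k)) 
      (cc q A B C) (fun n => coeff n (P * H)) h1' h2 ?_ ?_ hPH n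
    · rw [h00]; simp [cc, qPoch_zero]
    · intro k
      rw [cc_rec q A B C h1 h2 k]; ring

/-! analytic part -/
noncomputable def uu (q a z : ℂ) (n k : ℕ) : ℂ :=
  qPoch q (a * q) n * qPoch q (a * z) (n + k) / (qPoch q q n * qPoch q z (n + k)) *
    q ^ (n * (n - 1) + n * k) * z ^ n

lemma uu_k (q a z : ℂ) (hz : ∀ k : ℕ, 1 - z * q ^ k ≠ 0) (n k : ℕ) :
    uu q a z n (k+1) * (1 - z * q ^ (n + k)) =
      uu q a z n k * ((1 - a * z * q ^ (n + k)) * q ^ n) := by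
  have e1 := hz (n+k)
  have e2 := qPoch_ne q z hz (n + k)
  have e3 : q ^ (n * (n - 1) + n * (k+1)) = q ^ (n * (n - 1) + n * k) * q ^ n := by
    rw [← pow_add]; ring_nf
  simp only [uu, ← add_assoc, qPoch_succ, e3]
  generalize q ^ (n + k) = y at *
  field_simp

lemma uu_n (q a z : ℂ) (h1 : ∀ k : ℕ, 1 - q * q ^ k ≠ 0) (hz : ∀ k : ℕ, 1 - z * q ^ k ≠ 0)
    (n k : ℕ) :
    uu q a z (n+1) k * ((1 - q * q ^ n) * (1 - z * q ^ (n + k))) =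
      uu q a z n k * ((1 - a * q * q ^ n) * (1 - a * z * q ^ (n + k)) * (z * q ^ n * q ^ (n + k))) := by
  have e1 := hz (n+k)
  have e2 := qPoch_ne q z hz (n + k)
  have e4 := h1 n
  have e5 := qPoch_ne q q h1 n
  have e3 : q ^ ((n + 1) * (n + 1 - 1) + (n + 1) * k) =
      q ^ (n * (n - 1) + n * k) * q ^ n * q ^ (n + k) := by
    rw [← pow_add, ← pow_add]
    congr 1
    cases n with
    | zero => simp
    | succ m => simp only [Nat.add_sub_cancel]; ring
  have e6 : n + 1 + k = n + k + 1 := by ring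
  simp only [uu, e6, qPoch_succ, e3]
  generalize q ^ (n + k) = y at *
  generalize q ^ n = x at *
  field_simp
  ring

noncomputable def ss (q a z : ℂ) (n k : ℕ) : ℂ := uu q a z n k * (1 - a * z * q ^ (2 * n + k))

lemma ss_tele (q a z : ℂ) (h1 : ∀ k : ℕ, 1 - q * q ^ k ≠ 0) (hz : ∀ k : ℕ, 1 - z * q ^ k ≠ 0)
    (n k : ℕ) :
    ss q a z n (k+1) - ss q a z n k =
      (1 - q ^ (n+1)) * uu q a z (n+1) k - (1 - q ^ n) * uu q a z n k := by
  have e1 := hz (n+k)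
  have hk := uu_k q a z hz n k
  have hn := uu_n q a z h1 hz n k
  have p1 : q ^ (2 * n + (k + 1)) = q * q ^ n * q ^ (n + k) := by
    rw [← pow_succ', ← pow_add]; ring_nf
  have p2 : q ^ (2 * n + k) = q ^ n * q ^ (n + k) := by
    rw [← pow_add]; ring_nf
  have p3 : q ^ (n+1) = q * q ^ n := pow_succ' _ _
  simp only [ss, p1, p2, p3]
  generalize q ^ (n + k) = y at *
  generalize q ^ n = x at *
  apply mul_right_cancel₀ e1
  linear_combination (1 - a * z * (q * x * y)) * hk - hn

lemma uu_bdd (q a z : ℂ) (hq : ‖q‖ < 1) (hz : ‖z‖ < 1) :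
    ∃ M : ℝ, 0 ≤ M ∧ ∀ n k, ‖uu q a z n k‖ ≤ M * ‖z‖ ^ n := by
  obtain ⟨M1, h1, H1⟩ := qPoch_bdd q (a * q) hq
  obtain ⟨M2, h2, H2⟩ := qPoch_bdd q (a * z) hq
  obtain ⟨M3, h3, H3⟩ := qPoch_inv_bdd q q hq (one_sub_ne q q hq hq)
  obtain ⟨M4, h4, H4⟩ := qPoch_inv_bdd q z hq (one_sub_ne q z hq hz)
  refine ⟨M1 * M2 * (M3 * M4) * 1, by positivity, fun n k => ?_⟩
  rw [uu, div_eq_mul_inv, mul_inv]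
  simp only [norm_mul, norm_pow]
  gcongr
  · exact H1 n
  · exact H2 _
  · exact H3 n
  · exact H4 _
  · exact pow_le_one₀ (norm_nonneg _) hq.le

lemma one_sub_bdd (q y : ℂ) (hq : ‖q‖ < 1) (n : ℕ) : ‖1 - y * q ^ n‖ ≤ 1 + ‖y‖ := by
  calc ‖1 - y * q ^ n‖ ≤ ‖(1:ℂ)‖ + ‖y * q ^ n‖ := norm_sub_le _ _
    _ ≤ 1 + ‖y‖ * 1 := by
      rw [norm_one, norm_mul, norm_pow]
      gcongr
      exact pow_le_one₀ (norm_nonneg _) hq.le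
    _ = _ := by ring

lemma ss_bdd (q a z : ℂ) (hq : ‖q‖ < 1) (hz : ‖z‖ < 1) :
    ∃ M : ℝ, 0 ≤ M ∧ ∀ n k, ‖ss q a z n k‖ ≤ M * ‖z‖ ^ n := by
  obtain ⟨M, h, H⟩ := uu_bdd q a z hq hz
  refine ⟨M * (1 + ‖a * z‖), by positivity, fun n k => ?_⟩
  rw [ss, norm_mul]
  calc _ ≤ (M * ‖z‖ ^ n) * (1 + ‖a * z‖) := by
        gcongr
        · exact H n k
        · exact one_sub_bdd _ _ hq _
    _ = _ := by ring

lemma ss_summable (q a z : ℂ) (hq : ‖q‖ < 1) (hz : ‖z‖ < 1) (k : ℕ) :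
    Summable fun n => ss q a z n k := by
  obtain ⟨M, h, H⟩ := ss_bdd q a z hq hz
  exact Summable.of_norm_bounded
    ((summable_geometric_of_lt_one (norm_nonneg z) hz).mul_left M) fun n => H n k

section
open Filter Topology

lemma ss_step (q a z : ℂ) (hq : ‖q‖ < 1) (hz : ‖z‖ < 1) (k : ℕ) :
    ∑' n, ss q a z n (k+1) = ∑' n, ss q a z n k := by
  have s1 := ss_summable q a z hq hz (k+1)
  have s2 := ss_summable q a z hq hz k
  have t1 := (s1.sub s2).hasSum.tendsto_sum_nat
  rw [s1.tsum_sub s2] at t1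
  have hG : Tendsto (fun N => (1 - q ^ N) * uu q a z N k) atTop (𝓝 0) := by
    obtain ⟨M, h, H⟩ := uu_bdd q a z hq hz
    apply squeeze_zero_norm (a := fun N => 2 * (M * ‖z‖ ^ N))
    · intro N
      rw [norm_mul]
      gcongr
      · have := one_sub_bdd q 1 hq N
        rw [one_mul, norm_one] at this
        linarith
      · exact H N k
    · have := ((tendsto_pow_atTop_nhds_zero_of_lt_one (norm_nonneg z) hz).const_mul M).const_mul 2
      simpa using this
  have t2 : ∀ N, ∑ n ∈ Finset.range N, (ss q a z n (k+1) - ss q a z n k)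
      = (1 - q ^ N) * uu q a z N k := by
    intro N
    rw [Finset.sum_congr rfl fun n _ => ss_tele q a z (one_sub_ne q q hq hq)
      (one_sub_ne q z hq hz) n k, Finset.sum_range_sub (fun n => (1 - q ^ n) * uu q a z n k)]
    simp
  simp only [t2] at t1
  exact sub_eq_zero.mp (tendsto_nhds_unique t1 hG)

lemma ss_const (q a z : ℂ) (hq : ‖q‖ < 1) (hz : ‖z‖ < 1) (k : ℕ) :
    ∑' n, ss q a z n k = ∑' n, ss q a z n 0 := by
  induction k with
  | zero => rfl
  | succ k ih => rw [ss_step q a z hq hz, ih]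

lemma pp_bdd (q a : ℂ) (hq : ‖q‖ < 1) : ∃ M : ℝ, ∀ n, ‖pp q a n‖ ≤ M := by
  obtain ⟨M1, h1, H1⟩ := qPoch_bdd q a hq
  obtain ⟨M3, h3, H3⟩ := qPoch_inv_bdd q q hq (one_sub_ne q q hq hq)
  refine ⟨M1 * M3, fun n => ?_⟩
  rw [pp, div_eq_mul_inv, norm_mul]
  gcongr
  · exact H1 n
  · exact H3 n

lemma cc_bdd (q A B C : ℂ) (hq : ‖q‖ < 1) (h2 : ∀ k : ℕ, 1 - C * q ^ k ≠ 0) :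
    ∃ M : ℝ, 0 ≤ M ∧ ∀ n, ‖cc q A B C n‖ ≤ M := by
  obtain ⟨M1, h1, H1⟩ := qPoch_bdd q A hq
  obtain ⟨M2, h2', H2⟩ := qPoch_bdd q B hq
  obtain ⟨M3, h3, H3⟩ := qPoch_inv_bdd q q hq (one_sub_ne q q hq hq)
  obtain ⟨M4, h4, H4⟩ := qPoch_inv_bdd q C hq h2
  refine ⟨M1 * M2 * (M3 * M4), by positivity, fun n => ?_⟩
  rw [cc, div_eq_mul_inv, mul_inv]
  simp only [norm_mul]
  gcongr
  · exact H1 n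
  · exact H2 _
  · exact H3 n
  · exact H4 _

/-- the q-binomial function -/
noncomputable def PP (q a w : ℂ) : ℂ := ∑' m, pp q a m * w ^ m

lemma PP_summable (q a w : ℂ) (hq : ‖q‖ < 1) (hw : ‖w‖ < 1) :
    Summable fun m => pp q a m * w ^ m := by
  obtain ⟨M, H⟩ := pp_bdd q a hq
  exact (geo_summable _ M H w hw).of_norm

lemma PP_eq (q a w : ℂ) (hq : ‖q‖ < 1) (hw : ‖w‖ < 1) :
    (1 - w) * PP q a w = (1 - a * w) * PP q a (w * q) := by
  have hwq : ‖w * q‖ < 1 := by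
    rw [norm_mul]; nlinarith [norm_nonneg w, norm_nonneg q]
  have s1 := PP_summable q a w hq hw
  have s2 := PP_summable q a (w * q) hq hwq
  have e1 : PP q a w = 1 + ∑' m, pp q a (m+1) * w ^ (m+1) := by
    rw [PP, s1.tsum_eq_zero_add]; simp [pp, qPoch_zero]
  have e2 : PP q a (w * q) = 1 + ∑' m, pp q a (m+1) * (w * q) ^ (m+1) := by
    rw [PP, s2.tsum_eq_zero_add]; simp [pp, qPoch_zero]
  have s1' := (summable_nat_add_iff 1).mpr s1
  have s2' := (summable_nat_add_iff 1).mpr s2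
  have e3 : PP q a w - PP q a (w * q) = w * PP q a w - a * w * PP q a (w * q) := by
    calc PP q a w - PP q a (w * q)
        = ∑' m, (pp q a (m+1) * w ^ (m+1) - pp q a (m+1) * (w * q) ^ (m+1)) := by
          rw [s1'.tsum_sub s2', e1, e2]; ring
      _ = ∑' m, (w * (pp q a m * w ^ m) - a * w * (pp q a m * (w * q) ^ m)) := by
          congr 1; ext m
          have := pp_rec q a (one_sub_ne q q hq hq) m
          rw [mul_pow, mul_pow]
          linear_combination w ^ (m+1) * this
      _ = _ := by
          rw [(s1.mul_left w).tsum_sub (s2.mul_left (a * w)), tsum_mul_left, tsum_mul_left]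
          rfl
  linear_combination e3

lemma PP_iter (q a z : ℂ) (hq : ‖q‖ < 1) (hz : ‖z‖ < 1) (N : ℕ) :
    PP q a z = qPoch q (a * z) N / qPoch q z N * PP q a (z * q ^ N) := by
  induction N with
  | zero => simp [qPoch_zero]
  | succ N ih =>
    have hzN : ‖z * q ^ N‖ < 1 := by
      rw [norm_mul, norm_pow]
      have := pow_le_one₀ (norm_nonneg q) hq.le (n := N)
      nlinarith [norm_nonneg z, pow_nonneg (norm_nonneg q) N]
    have h := PP_eq q a (z * q ^ N) hq hzN
    have e1 := one_sub_ne q z hq hz N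
    have e2 := qPoch_ne q z (one_sub_ne q z hq hz) N
    rw [ih, qPoch_succ, qPoch_succ, pow_succ, ← mul_assoc z]
    generalize PP q a (z * q ^ N * q) = Y at *
    generalize PP q a (z * q ^ N) = Y' at *
    generalize q ^ N = y at *
    field_simp
    linear_combination qPoch q (a * z) N * h

lemma PP_tendsto (q a z : ℂ) (hq : ‖q‖ < 1) (hz : ‖z‖ < 1) :
    Tendsto (fun N : ℕ => PP q a (z * q ^ N)) atTop (𝓝 1) := by
  obtain ⟨M, H⟩ := pp_bdd q a hq
  have hM : 0 ≤ M := (norm_nonneg _).trans (H 0)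
  have := tendsto_tsum_of_dominated_convergence (𝓕 := atTop)
    (f := fun (N : ℕ) (m : ℕ) => pp q a m * (z * q ^ N) ^ m)
    (g := fun m => if m = 0 then (1:ℂ) else 0) (bound := fun m => M * ‖z‖ ^ m)
    ((summable_geometric_of_lt_one (norm_nonneg z) hz).mul_left M) ?_ ?_
  · simpa [PP] using this
  · intro m
    by_cases hm : m = 0
    · subst hm; simp [pp, qPoch_zero]
    · have h0 := (((tendsto_pow_atTop_nhds_zero_of_norm_lt_one hq).const_mul z).pow m).const_mul
        (pp q a m)
      simpa [hm] using h0
  · refine Eventually.of_forall fun N m => ?_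
    rw [norm_mul, norm_pow, norm_mul, norm_pow]
    gcongr
    · exact H m
    · exact mul_le_of_le_one_right (norm_nonneg _) (pow_le_one₀ (norm_nonneg _) hq.le)

lemma R_tendsto (q a z : ℂ) (hq : ‖q‖ < 1) (hz : ‖z‖ < 1) :
    Tendsto (fun N : ℕ => qPoch q (a * z) N / qPoch q z N) atTop (𝓝 (PP q a z)) := by
  have h := PP_tendsto q a z hq hz
  have h2 := (tendsto_const_nhds (x := PP q a z)).div h one_ne_zero
  rw [div_one] at h2
  apply h2.congr'
  filter_upwards [h.eventually_ne one_ne_zero] with N hN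
  simp only [Pi.div_apply]
  rw [div_eq_iff hN]
  exact PP_iter q a z hq hz N

lemma ss_sum (q a z : ℂ) (hq : ‖q‖ < 1) (hz : ‖z‖ < 1) (k : ℕ) :
    ∑' n, ss q a z n k = PP q a z := by
  obtain ⟨M, hM, H⟩ := ss_bdd q a z hq hz
  obtain ⟨M', hM', H'⟩ := uu_bdd q a z hq hz
  have := tendsto_tsum_of_dominated_convergence (𝓕 := atTop)
    (f := fun (k : ℕ) (n : ℕ) => ss q a z n k)
    (g := fun m => if m = 0 then PP q a z else 0) (bound := fun m => M * ‖z‖ ^ m)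
    ((summable_geometric_of_lt_one (norm_nonneg z) hz).mul_left M) ?_ ?_
  · simp only [ss_const q a z hq hz] at this
    rw [ss_const q a z hq hz, tendsto_nhds_unique tendsto_const_nhds this]
    simp
  · intro n
    by_cases hn : n = 0
    · subst hn
      have h0 := ((tendsto_pow_atTop_nhds_zero_of_norm_lt_one hq).const_mul (a * z)).const_sub 1
      have := (R_tendsto q a z hq hz).mul h0
      simpa [ss, uu, qPoch_zero] using this
    · simp only [hn, if_false]
      obtain ⟨M1, h1, H1⟩ := qPoch_bdd q (a * q) hq
      have h0 := ((tendsto_pow_atTop_nhds_zero_of_norm_lt_one hq).const_mul (a * z * q ^ (2 * n))).const_sub 1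
      have hp : Tendsto (fun k : ℕ => q ^ (n * (n-1)) * (q ^ k) ^ n) atTop (𝓝 0) := by
        have := ((tendsto_pow_atTop_nhds_zero_of_norm_lt_one hq).pow n).const_mul (q ^ (n * (n-1)))
        simpa [hn] using this
      have hR := (R_tendsto q a z hq hz).comp (tendsto_add_atTop_nat n)
      have := (((hR.mul hp).mul h0).const_mul (qPoch q (a * q) n / qPoch q q n * z ^ n))
      simp only [mul_zero, zero_mul] at this
      apply this.congr
      intro k
      have e : q ^ (n * (n - 1) + n * k) = q ^ (n * (n - 1)) * (q ^ k) ^ n := by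
        rw [pow_add, ← pow_mul, mul_comm n k]
      simp only [ss, uu, Function.comp, add_comm n k, e, pow_add q (2 * n) k]
      rw [mul_div_mul_comm]; ring
  · exact Eventually.of_forall fun k n => H n k

end

lemma norm_mul_pow_lt (q w : ℂ) (hq : ‖q‖ < 1) (hw : ‖w‖ < 1) (n : ℕ) : ‖w * q ^ n‖ < 1 := by
  rw [norm_mul, norm_pow]
  have := pow_le_one₀ (norm_nonneg q) hq.le (n := n)
  nlinarith [norm_nonneg w, pow_nonneg (norm_nonneg q) n]

lemma phi_eq (q A B C z : ℂ) (n k : ℕ) : PhiTerm q A B C z n k =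
    cc q (C/A) (C/B) C k * (qPoch q (A * B / C * z * q ^ n) k *
      qPoch q (A * B / C * z * q ^ (2 * n) * q) k / (qPoch q (z * q ^ n) k *
      qPoch q (A * B / C * z * q ^ (2 * n)) k)) * (A * B / C * z * q ^ n) ^ k := by
  have e1 : A * B * z * q ^ n / C = A * B / C * z * q ^ n := by ring
  have e2 : A * B * z * q ^ (2 * n + 1) / C = A * B / C * z * q ^ (2 * n) * q := by ring
  have e3 : A * B * z * q ^ (2 * n) / C = A * B / C * z * q ^ (2 * n) := by ring
  rw [PhiTerm, e1, e2, e3, cc, ← mul_div_mul_comm]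
  ring

lemma phi_summable (q A B C z : ℂ) (hq : ‖q‖ < 1) (h2 : ∀ k : ℕ, 1 - C * q ^ k ≠ 0)
    (hz : ‖z‖ < 1) (haz : ‖A * B / C * z‖ < 1) (n : ℕ) :
    Summable fun k => PhiTerm q A B C z n k := by
  obtain ⟨M, hM, HM⟩ := cc_bdd q (C/A) (C/B) C hq h2
  obtain ⟨M1, hM1, H1⟩ := qPoch_bdd q (A * B / C * z * q ^ n) hq
  obtain ⟨M2, hM2, H2⟩ := qPoch_bdd q (A * B / C * z * q ^ (2 * n) * q) hq
  obtain ⟨M3, hM3, H3⟩ := qPoch_inv_bdd q (z * q ^ n) hq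
    (one_sub_ne q _ hq (norm_mul_pow_lt q z hq hz n))
  obtain ⟨M4, hM4, H4⟩ := qPoch_inv_bdd q (A * B / C * z * q ^ (2 * n)) hq
    (one_sub_ne q _ hq (norm_mul_pow_lt q _ hq haz (2 * n)))
  simp only [phi_eq]
  refine (geo_summable _ (M * (M1 * M2 * (M3 * M4))) (fun k => ?_) _
    (norm_mul_pow_lt q _ hq haz n)).of_norm
  rw [div_eq_mul_inv (_ * _) (_ * _), mul_inv]
  simp only [norm_mul]
  gcongr
  · exact HM k
  · exact H1 k
  · exact H2 k
  · exact H3 k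
  · exact H4 k

lemma main_term (q A B C z : ℂ) (hq : ‖q‖ < 1) (h2 : ∀ k : ℕ, 1 - C * q ^ k ≠ 0)
    (hz : ‖z‖ < 1) (haz : ‖A * B / C * z‖ < 1) (n k : ℕ) :
    qPoch q (A * B * q / C) n * qPoch q (A * B * z / C) n / (qPoch q q n * qPoch q z n) *
        z ^ n * q ^ (n * (n - 1)) * (1 - A * B * z * q ^ (2 * n) / C) * PhiTerm q A B C z n k =
      cc q (C/A) (C/B) C k * (A * B / C * z) ^ k * ss q (A * B / C) z n k := by
  have e1 : A * B * q / C = A * B / C * q := by ring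
  have e2 : A * B * z / C = A * B / C * z := by ring
  have e3 : A * B * z * q ^ (2 * n) / C = A * B / C * z * q ^ (2 * n) := by ring
  rw [phi_eq, e1, e2, e3, ss, uu]
  generalize A * B / C = a at *
  have n1 := qPoch_ne q _ (one_sub_ne q _ hq (norm_mul_pow_lt q _ hq haz (2 * n))) k
  have n2 := qPoch_ne q _ (one_sub_ne q _ hq (norm_mul_pow_lt q _ hq hz n)) k
  have n3 := qPoch_ne q _ (one_sub_ne q _ hq hz) n
  have n4 := qPoch_ne q _ (one_sub_ne q _ hq hq) n
  have hs := qPoch_shift q (a * z * q ^ (2 * n)) k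
  have p1 : q ^ (n * (n - 1) + n * k) = q ^ (n * (n - 1)) * (q ^ n) ^ k := by
    rw [pow_add, pow_mul q n k]
  have p2 : a * z * q ^ (2 * n + k) = a * z * q ^ (2 * n) * q ^ k := by rw [pow_add]; ring
  rw [qPoch_add, qPoch_add, p1, p2, mul_pow _ (q ^ n) k]
  generalize cc q (C/A) (C/B) C k = D
  generalize qPoch q (a * z * q ^ (2 * n) * q) k = Q1 at *
  generalize qPoch q (a * z * q ^ (2 * n)) k = Q2 at *
  generalize qPoch q (z * q ^ n) k = Q3 at *
  generalize qPoch q (a * z * q ^ n) k = Q4 at *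
  generalize qPoch q z n = Q5 at *
  generalize qPoch q q n = Q6 at *
  generalize qPoch q (a * z) n = Q7 at *
  generalize qPoch q (a * q) n = Q8 at *
  generalize a * z * q ^ (2 * n) = y at *
  generalize (a * z) ^ k = v at *
  generalize (q ^ n) ^ k = t at *
  generalize q ^ (n * (n - 1)) = t' at *
  generalize z ^ n = t'' at *
  generalize q ^ k = r at *
  field_simp
  linear_combination Q8 * Q7 * Q4 * D * v * t * t' * t'' * hs

/-- Transformation of the Gaussian `₂φ₁` series:
`₂φ₁(A,B;C;q,z) = ∑_n (ABq/C;q)_n (ABz/C;q)_n/((q;q)_n (z;q)_n)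
  z^n q^{n(n−1)} (1 − ABzq^{2n}/C) Φ_n`, all series converging absolutely. -/
theorem two_phi_one_transformation (q A B C z : ℂ) (hq : ‖q‖ < 1)
    (hA : A ≠ 0) (hB : B ≠ 0) (hC : C ≠ 0)
    (hCq : ∀ m : ℕ, C ≠ q ^ (-(m : ℤ)))
    (hz : ‖z‖ < 1) (hABz : ‖A * B * z / C‖ < 1) :
    Summable (fun k : ℕ =>
      qPoch q A k * qPoch q B k / (qPoch q q k * qPoch q C k) * z ^ k) ∧
    (∀ n : ℕ, Summable (fun k : ℕ => PhiTerm q A B C z n k)) ∧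
    Summable (fun n : ℕ =>
      qPoch q (A * B * q / C) n * qPoch q (A * B * z / C) n /
          (qPoch q q n * qPoch q z n) *
        z ^ n * q ^ (n * (n - 1)) * (1 - A * B * z * q ^ (2 * n) / C) *
        ∑' k : ℕ, PhiTerm q A B C z n k) ∧
    ∑' k : ℕ, qPoch q A k * qPoch q B k / (qPoch q q k * qPoch q C k) * z ^ k
      = ∑' n : ℕ,
          qPoch q (A * B * q / C) n * qPoch q (A * B * z / C) n /
              (qPoch q q n * qPoch q z n) *
            z ^ n * q ^ (n * (n - 1)) * (1 - A * B * z * q ^ (2 * n) / C) *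
            ∑' k : ℕ, PhiTerm q A B C z n k := by
  
  have h1 := one_sub_ne q q hq hq
  have hz1 := one_sub_ne q z hq hz
  have h2 : ∀ k : ℕ, 1 - C * q ^ k ≠ 0 := by
    intro k h
    apply hCq k
    rw [zpow_neg, zpow_natCast]
    exact eq_inv_of_mul_eq_one_left (sub_eq_zero.mp h).symm
  have haz : ‖A * B / C * z‖ < 1 := by
    rwa [show A * B / C * z = A * B * z / C by ring]
  obtain ⟨M, hM, HM⟩ := cc_bdd q A B C hq h2
  obtain ⟨M2, hM2, HM2⟩ := cc_bdd q (C/A) (C/B) C hq h2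
  obtain ⟨M3, hM3, HM3⟩ := ss_bdd q (A * B / C) z hq hz
  have hsum := (geo_summable _ M HM z hz).of_norm
  have key := main_term q A B C z hq h2 hz haz
  have hT : Summable (Function.uncurry fun n k : ℕ =>
      cc q (C/A) (C/B) C k * (A * B / C * z) ^ k * ss q (A * B / C) z n k) := by
    have hb := (summable_geometric_of_lt_one (norm_nonneg z) hz).mul_of_nonneg
      (summable_geometric_of_lt_one (norm_nonneg _) haz)
      (fun n => pow_nonneg (norm_nonneg _) n) (fun n => pow_nonneg (norm_nonneg _) n)
    refine Summable.of_norm_bounded (hb.mul_left (M2 * M3)) ?_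
    rintro ⟨n, k⟩
    simp only [Function.uncurry]
    rw [norm_mul, norm_mul, norm_pow]
    calc _ ≤ M2 * ‖A * B / C * z‖ ^ k * (M3 * ‖z‖ ^ n) := by
          gcongr
          · exact HM2 k
          · exact HM3 n k
      _ = _ := by ring
  have hin : ∀ n : ℕ, qPoch q (A * B * q / C) n * qPoch q (A * B * z / C) n /
          (qPoch q q n * qPoch q z n) *
        z ^ n * q ^ (n * (n - 1)) * (1 - A * B * z * q ^ (2 * n) / C) *
        ∑' k : ℕ, PhiTerm q A B C z n k = ∑' k : ℕ,
        cc q (C/A) (C/B) C k * (A * B / C * z) ^ k * ss q (A * B / C) z n k := by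
    intro n
    rw [← tsum_mul_left]
    exact tsum_congr fun k => key n k
  refine ⟨hsum, fun n => phi_summable q A B C z hq h2 hz haz n, ?_, ?_⟩
  · simp only [hin]
    exact hT.prod
  · simp only [hin]
    rw [← hT.tsum_comm]
    simp only [tsum_mul_left, ss_sum q (A * B / C) z hq hz]
    rw [tsum_mul_right]
    obtain ⟨M4, HM4⟩ := pp_bdd q (A * B / C) hq
    rw [mul_comm, PP, tsum_mul_tsum_eq_tsum_sum_antidiagonal_of_summable_norm
      (geo_summable _ M4 HM4 z hz) (geo_summable _ M2 HM2 _ haz)]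
    refine tsum_congr fun n => ?_
    change cc q A B C n * z ^ n = _
    rw [saal q A B C hA hB hC h1 h2 n, Finset.sum_mul]
    refine Finset.sum_congr rfl fun ij hij => ?_
    rw [← Finset.HasAntidiagonal.mem_antidiagonal.mp hij, pow_add, mul_pow]
    ring
end
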